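/- arXiv:1111.0118 — 2 statements merged into one kernel-verified Lean document; each statement's English description precedes it below -/
import Mathlib

section
/- There exists a constant C > 0 such that for all continuously differentiable functions u, v: ℝ × ℝ² → ℂ, all (t, x) ∈ ℝ × ℝ², and all 0 ≤ a, b ≤ 2, one has |Q_{ab}(u, v)(t, x)| ≤ C ⟨|t| + |x|⟩^{−1} ( |u(t,x)|₁ |∂v(t,x)| + |∂u(t,x)| |v(t,x)|₁ ), where |∂u| = Σ_{c=0}^{2} |∂_c u| and ⟨y⟩ = (1 + y²)^{1/2}. -/
open MeasureTheory Matrix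

noncomputable section

/-- Partial derivative `∂_a` on spacetime `ℝ^{1+2}` (coordinates `p 0 = t`, `p 1 = x₁`, `p 2 = x₂`). -/
def pd {E : Type*} [NormedAddCommGroup E] [NormedSpace ℝ E]
    (a : Fin 3) (u : (Fin 3 → ℝ) → E) : (Fin 3 → ℝ) → E :=
  fun p => fderiv ℝ u p (Pi.single a 1)

/-- d'Alembertian `□ = ∂_t² − ∂_1² − ∂_2²`. -/
def Box {E : Type*} [NormedAddCommGroup E] [NormedSpace ℝ E]
    (u : (Fin 3 → ℝ) → E) : (Fin 3 → ℝ) → E :=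
  fun p => pd 0 (pd 0 u) p - pd 1 (pd 1 u) p - pd 2 (pd 2 u) p

/-- Coordinate function with `x₀ = −t`, `x₁`, `x₂`. -/
def Xc (a : Fin 3) (p : Fin 3 → ℝ) : ℝ := if a = 0 then -(p 0) else p a

/-- The vector fields `Ω_{ab} = x_a ∂_b − x_b ∂_a`. -/
def Omg {E : Type*} [NormedAddCommGroup E] [NormedSpace ℝ E]
    (a b : Fin 3) (u : (Fin 3 → ℝ) → E) : (Fin 3 → ℝ) → E :=
  fun p => Xc a p • pd b u p - Xc b p • pd a u p

/-- Minkowski metric coefficients `(η_{ab}) = diag(−1,1,1)`. -/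
def eta (a b : Fin 3) : ℝ := if a = b then (if a = 0 then -1 else 1) else 0

/-- The family of vector fields `Z = (∂_t, ∂_1, ∂_2, Ω_{01}, Ω_{02}, Ω_{12})`. -/
def Zop {E : Type*} [NormedAddCommGroup E] [NormedSpace ℝ E] :
    Fin 6 → ((Fin 3 → ℝ) → E) → ((Fin 3 → ℝ) → E) :=
  ![pd 0, pd 1, pd 2, Omg 0 1, Omg 0 2, Omg 1 2]

/-- The null form `Q₀(u,v) = (∂_t u)(∂_t v) − (∂_1 u)(∂_1 v) − (∂_2 u)(∂_2 v)`. -/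
def Q0 (u v : (Fin 3 → ℝ) → ℂ) : (Fin 3 → ℝ) → ℂ :=
  fun p => pd 0 u p * pd 0 v p - pd 1 u p * pd 1 v p - pd 2 u p * pd 2 v p

/-- The strong null forms `Q_{ab}(u,v) = (∂_a u)(∂_b v) − (∂_b u)(∂_a v)`. -/
def Qab (a b : Fin 3) (u v : (Fin 3 → ℝ) → ℂ) : (Fin 3 → ℝ) → ℂ :=
  fun p => pd a u p * pd b v p - pd b u p * pd a v p

theorem Omg_swap {E : Type*} [NormedAddCommGroup E] [NormedSpace ℝ E]
    (a b : Fin 3) (u : (Fin 3 → ℝ) → E) (p : Fin 3 → ℝ) :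
    Omg b a u p = -Omg a b u p := by
  simp only [Omg]
  abel

theorem norm_Omg_le_sum_Zop {E : Type*} [NormedAddCommGroup E] [NormedSpace ℝ E]
    (a b : Fin 3) (u : (Fin 3 → ℝ) → E) (p : Fin 3 → ℝ) :
    ‖Omg a b u p‖ ≤ ∑ j : Fin 6, ‖Zop j u p‖ := by
  have hself (c : Fin 3) : ‖Omg c c u p‖ ≤ ∑ j : Fin 6, ‖Zop j u p‖ := by
    simp only [Omg, sub_self, norm_zero]
    positivity
  have hZ (j : Fin 6) : ‖Zop j u p‖ ≤ ∑ j : Fin 6, ‖Zop j u p‖ :=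
    Finset.single_le_sum (f := fun j => ‖Zop j u p‖)
      (fun _ _ => norm_nonneg _) (Finset.mem_univ j)
  have hswap (c d : Fin 3) : ‖Omg d c u p‖ = ‖Omg c d u p‖ := by
    rw [Omg_swap c d, norm_neg]
  have h01 : ‖Omg 0 1 u p‖ ≤ ∑ j : Fin 6, ‖Zop j u p‖ := hZ 3
  have h02 : ‖Omg 0 2 u p‖ ≤ ∑ j : Fin 6, ‖Zop j u p‖ := hZ 4
  have h12 : ‖Omg 1 2 u p‖ ≤ ∑ j : Fin 6, ‖Zop j u p‖ := hZ 5
  fin_cases a <;> fin_cases b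
  exacts [hself 0, h01, h02, (hswap 0 1).trans_le h01, hself 1, h12,
    (hswap 0 2).trans_le h02, (hswap 1 2).trans_le h12, hself 2]

theorem sum_pd_le_sum_Zop {E : Type*} [NormedAddCommGroup E] [NormedSpace ℝ E]
    (u : (Fin 3 → ℝ) → E) (p : Fin 3 → ℝ) :
    ∑ c : Fin 3, ‖pd c u p‖ ≤ ∑ j : Fin 6, ‖Zop j u p‖ := by
  rw [Fin.sum_univ_three, Fin.sum_univ_six]
  change _ ≤ ‖pd 0 u p‖ + ‖pd 1 u p‖ + ‖pd 2 u p‖ + _ + _ + _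
  linarith [norm_nonneg (Zop 3 u p), norm_nonneg (Zop 4 u p), norm_nonneg (Zop 5 u p)]

theorem norm_pd_le_sum_pd {E : Type*} [NormedAddCommGroup E] [NormedSpace ℝ E]
    (a : Fin 3) (u : (Fin 3 → ℝ) → E) (p : Fin 3 → ℝ) :
    ‖pd a u p‖ ≤ ∑ c : Fin 3, ‖pd c u p‖ :=
  Finset.single_le_sum (f := fun c => ‖pd c u p‖)
    (fun _ _ => norm_nonneg _) (Finset.mem_univ a)

/-- Multiplying `Q_{ab}` by a coordinate produces only products of one rotation or boost
with one derivative. -/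
theorem Xc_smul_Qab (a b c : Fin 3) (u v : (Fin 3 → ℝ) → ℂ) (p : Fin 3 → ℝ) :
    Xc c p • Qab a b u v p
      = Omg c a u p * pd b v p - Omg c b u p * pd a v p + pd c u p * Omg a b v p := by
  simp only [Qab, Omg, Complex.real_smul]
  ring

theorem sqrt_one_add_sq_le (t x y : ℝ) :
    Real.sqrt (1 + (|t| + Real.sqrt (x ^ 2 + y ^ 2)) ^ 2) ≤ 1 + |t| + |x| + |y| := by
  have hxy : Real.sqrt (x ^ 2 + y ^ 2) ≤ |x| + |y| := by
    refine Real.sqrt_le_iff.2 ⟨by positivity, ?_⟩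
    nlinarith [sq_abs x, sq_abs y, mul_nonneg (abs_nonneg x) (abs_nonneg y)]
  have hr : 0 ≤ |t| + Real.sqrt (x ^ 2 + y ^ 2) := by positivity
  refine Real.sqrt_le_iff.2 ⟨by positivity, ?_⟩
  nlinarith

/-- the strong null forms gain a decay factor `⟨|t|+|x|⟩⁻¹`:
`|Q_{ab}(u,v)| ≤ C ⟨|t|+|x|⟩⁻¹ (|u|₁|∂v| + |∂u||v|₁)`. -/
theorem null_form_decay :
    ∃ C > (0 : ℝ), ∀ u v : (Fin 3 → ℝ) → ℂ, ContDiff ℝ 1 u → ContDiff ℝ 1 v →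
      ∀ (p : Fin 3 → ℝ) (a b : Fin 3),
        ‖Qab a b u v p‖
          ≤ C / Real.sqrt (1 + (|p 0| + Real.sqrt ((p 1) ^ 2 + (p 2) ^ 2)) ^ 2) *
            ((‖u p‖ + ∑ j : Fin 6, ‖Zop j u p‖) * (∑ c : Fin 3, ‖pd c v p‖)
              + (∑ c : Fin 3, ‖pd c u p‖) * (‖v p‖ + ∑ j : Fin 6, ‖Zop j v p‖)) := by
  refine ⟨8, by norm_num, fun u v _ _ p a b => ?_⟩
  set U := ‖u p‖ + ∑ j : Fin 6, ‖Zop j u p‖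
  set V := ‖v p‖ + ∑ j : Fin 6, ‖Zop j v p‖
  set A := ∑ c : Fin 3, ‖pd c u p‖
  set B := ∑ c : Fin 3, ‖pd c v p‖
  have hA0 : 0 ≤ A := by positivity
  have hB0 : 0 ≤ B := by positivity
  have hU0 : 0 ≤ U := by positivity
  have hV0 : 0 ≤ V := by positivity
  have hAU : A ≤ U := (sum_pd_le_sum_Zop u p).trans (le_add_of_nonneg_left (norm_nonneg _))
  have hOu (c d : Fin 3) : ‖Omg c d u p‖ ≤ U :=
    (norm_Omg_le_sum_Zop c d u p).trans (le_add_of_nonneg_left (norm_nonneg _))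
  have hOv (c d : Fin 3) : ‖Omg c d v p‖ ≤ V :=
    (norm_Omg_le_sum_Zop c d v p).trans (le_add_of_nonneg_left (norm_nonneg _))
  have hdu (c : Fin 3) : ‖pd c u p‖ ≤ A := norm_pd_le_sum_pd c u p
  have hdv (c : Fin 3) : ‖pd c v p‖ ≤ B := norm_pd_le_sum_pd c v p
  have hAV : 0 ≤ A * V := mul_nonneg hA0 hV0
  have hQ : ‖Qab a b u v p‖ ≤ 2 * (U * B + A * V) :=
    calc ‖Qab a b u v p‖ ≤ ‖pd a u p‖ * ‖pd b v p‖ + ‖pd b u p‖ * ‖pd a v p‖ := by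
          simpa only [Qab, norm_mul] using norm_sub_le (pd a u p * pd b v p) (pd b u p * pd a v p)
      _ ≤ U * B + U * B := by
          gcongr
          exacts [(hdu a).trans hAU, hdv b, (hdu b).trans hAU, hdv a]
      _ ≤ 2 * (U * B + A * V) := by linarith
  have hX (c : Fin 3) : |p c| * ‖Qab a b u v p‖ ≤ 2 * (U * B + A * V) :=
    calc |p c| * ‖Qab a b u v p‖ = ‖Xc c p • Qab a b u v p‖ := by
          rw [norm_smul, Real.norm_eq_abs, Xc]
          split_ifs with h <;> simp [h]
      _ ≤ ‖Omg c a u p‖ * ‖pd b v p‖ + ‖Omg c b u p‖ * ‖pd a v p‖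
            + ‖pd c u p‖ * ‖Omg a b v p‖ := by
          rw [Xc_smul_Qab]
          simp only [← norm_mul]
          exact (norm_add_le _ _).trans (by gcongr; exact norm_sub_le _ _)
      _ ≤ U * B + U * B + A * V := by
          gcongr
          exacts [hOu c a, hdv b, hOu c b, hdv a, hdu c, hOv a b]
      _ ≤ 2 * (U * B + A * V) := by linarith
  rw [div_mul_eq_mul_div, le_div_iff₀ (by positivity)]
  calc ‖Qab a b u v p‖ * Real.sqrt (1 + (|p 0| + Real.sqrt ((p 1) ^ 2 + (p 2) ^ 2)) ^ 2)
      ≤ ‖Qab a b u v p‖ * (1 + |p 0| + |p 1| + |p 2|) := by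
        gcongr
        exact sqrt_one_add_sq_le _ _ _
    _ ≤ 8 * (U * B + A * V) := by linarith [hX 0, hX 1, hX 2]

end
end

section
/- Let m_j, m_k, m_l ∈ ℝ. There exist real constants C^{(1)}_{abμν} (0 ≤ a, b ≤ 2, spacetime multi-indices |μ|, |ν| ≤ 1), C^{(2)}_{μν}, C^{(3)}_{μν} (|μ|, |ν| ≤ 1), and C^{(4)}, depending only on m_j, m_k, m_l, such that for all four-times continuously differentiable v, ṽ: ℝ × ℝ² → ℂ, setting h = (□ + m_k²)v and h̃ = (□ + m_l²)ṽ, one has (□ + m_j²)Q₀(v, ṽ) = 2 m_k² m_l² v ṽ + (m_j² − m_k² − m_l²) Q₀(v, ṽ) + Σ C^{(1)}_{abμν} Q_{ab}(∂^μ v, ∂^ν ṽ) + Σ C^{(2)}_{μν} (∂^μ v)(∂^ν h̃) + Σ C^{(3)}_{μν} (∂^μ h)(∂^ν ṽ) + C^{(4)} h h̃. -/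
open MeasureTheory Matrix

noncomputable section

/-- `∂^μ` for a spacetime multi-index of order `≤ 1`: `none` is the identity operator
(order `0`), and `some a` is `∂_a` (order `1`). -/
def pdOpt {E : Type*} [NormedAddCommGroup E] [NormedSpace ℝ E] :
    Option (Fin 3) → ((Fin 3 → ℝ) → E) → ((Fin 3 → ℝ) → E)
  | none => id
  | some a => pd a

section PartialDerivatives

variable {E : Type*} [NormedAddCommGroup E] [NormedSpace ℝ E]

theorem ContDiff.pd {n m : WithTop ℕ∞} {u : (Fin 3 → ℝ) → E} (hu : ContDiff ℝ n u)
    (h : m + 1 ≤ n) (a : Fin 3) : ContDiff ℝ m (pd a u) :=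
  (hu.fderiv_right h).clm_apply contDiff_const

theorem pd_add {u w : (Fin 3 → ℝ) → E} (hu : Differentiable ℝ u) (hw : Differentiable ℝ w)
    (a : Fin 3) : pd a (fun p => u p + w p) = fun p => pd a u p + pd a w p := by
  funext p
  simp [pd, fderiv_fun_add (hu p) (hw p)]

theorem pd_sub {u w : (Fin 3 → ℝ) → E} (hu : Differentiable ℝ u) (hw : Differentiable ℝ w)
    (a : Fin 3) : pd a (fun p => u p - w p) = fun p => pd a u p - pd a w p := by
  funext p
  simp [pd, fderiv_fun_sub (hu p) (hw p)]

theorem pd_const_smul {u : (Fin 3 → ℝ) → E} (hu : Differentiable ℝ u) (c : ℝ) (a : Fin 3) :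
    pd a (fun p => c • u p) = fun p => c • pd a u p := by
  funext p
  simp [pd, fderiv_fun_const_smul (hu p)]

theorem pd_mul {u w : (Fin 3 → ℝ) → ℂ} (hu : Differentiable ℝ u) (hw : Differentiable ℝ w)
    (a : Fin 3) : pd a (fun p => u p * w p) = fun p => pd a u p * w p + u p * pd a w p := by
  funext p
  simp [pd, fderiv_fun_mul (hu p) (hw p)]
  ring

theorem pd_comm {u : (Fin 3 → ℝ) → E} (hu : ContDiff ℝ 2 u) (a b : Fin 3) :
    pd a (pd b u) = pd b (pd a u) := by
  funext p
  have hd : DifferentiableAt ℝ (fderiv ℝ u) p :=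
    (hu.fderiv_right (m := 1) (by norm_num)).differentiable (by norm_num) p
  have key (c d : Fin 3) : pd c (pd d u) p
      = fderiv ℝ (fderiv ℝ u) p (Pi.single c 1) (Pi.single d 1) := by
    unfold pd
    rw [fderiv_clm_apply hd (differentiableAt_const _)]
    simp
  rw [key, key]
  exact (hu.contDiffAt.isSymmSndFDerivAt (by simp)) _ _

theorem Box_sub {u w : (Fin 3 → ℝ) → E} (hu : ContDiff ℝ 2 u) (hw : ContDiff ℝ 2 w) :
    Box (fun p => u p - w p) = fun p => Box u p - Box w p := by
  funext p
  have hdu := hu.differentiable (by norm_num)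
  have hdw := hw.differentiable (by norm_num)
  have hdu' (a : Fin 3) := (hu.pd (m := 1) (by norm_num) a).differentiable (by norm_num)
  have hdw' (a : Fin 3) := (hw.pd (m := 1) (by norm_num) a).differentiable (by norm_num)
  simp only [Box, pd_sub hdu hdw, pd_sub (hdu' _) (hdw' _)]
  abel

theorem pd_Box {u : (Fin 3 → ℝ) → E} (hu : ContDiff ℝ 3 u) (a : Fin 3) :
    pd a (Box u) = Box (pd a u) := by
  have hu2 : ContDiff ℝ 2 u := hu.of_le (by norm_num)
  have hd (b c : Fin 3) : Differentiable ℝ (pd b (pd c u)) :=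
    ((hu.pd (m := 2) (by norm_num) c).pd (m := 1) (by norm_num) b).differentiable (by norm_num)
  have hc (b : Fin 3) : pd a (pd b (pd b u)) = pd b (pd b (pd a u)) := by
    rw [pd_comm (hu.pd (by norm_num) b) a b, pd_comm hu2 a b]
  unfold Box
  rw [pd_sub ((hd 0 0).fun_sub (hd 1 1)) (hd 2 2), pd_sub (hd 0 0) (hd 1 1), hc, hc, hc]

theorem ContDiff.Box {u : (Fin 3 → ℝ) → E} (hu : ContDiff ℝ 3 u) : ContDiff ℝ 1 (Box u) := by
  have h (a : Fin 3) : ContDiff ℝ 1 (_root_.pd a (_root_.pd a u)) :=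
    (hu.pd (m := 2) (by norm_num) a).pd (by norm_num) a
  exact ((h 0).sub (h 1)).sub (h 2)

theorem pd_Box_add_smul {u : (Fin 3 → ℝ) → E} (hu : ContDiff ℝ 3 u) (c : ℝ) (a : Fin 3) :
    pd a (fun p => Box u p + c • u p) = fun p => Box (pd a u) p + c • pd a u p := by
  have hd := hu.differentiable (by norm_num)
  rw [pd_add (hu.Box.differentiable (by norm_num)) (hd.fun_const_smul c), pd_Box hu,
    pd_const_smul hd]

end PartialDerivatives

theorem Box_mul {u w : (Fin 3 → ℝ) → ℂ} (hu : ContDiff ℝ 2 u) (hw : ContDiff ℝ 2 w) :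
    Box (fun p => u p * w p) = fun p => Box u p * w p + u p * Box w p + 2 * Q0 u w p := by
  funext p
  have hdu := hu.differentiable (by norm_num)
  have hdw := hw.differentiable (by norm_num)
  have hdu' (a : Fin 3) := (hu.pd (m := 1) (by norm_num) a).differentiable (by norm_num)
  have hdw' (a : Fin 3) := (hw.pd (m := 1) (by norm_num) a).differentiable (by norm_num)
  have h (a : Fin 3) : pd a (pd a (fun p => u p * w p)) p
      = pd a (pd a u) p * w p + 2 * (pd a u p * pd a w p) + u p * pd a (pd a w) p := by
    rw [pd_mul hdu hdw, pd_add ((hdu' a).fun_mul hdw) (hdu.fun_mul (hdw' a)), pd_mul (hdu' a) hdw,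
      pd_mul hdu (hdw' a)]
    ring
  simp only [Box, Q0, h]
  ring

theorem Box_Q0 {v w : (Fin 3 → ℝ) → ℂ} (hv : ContDiff ℝ 3 v) (hw : ContDiff ℝ 3 w)
    (p : Fin 3 → ℝ) :
    Box (Q0 v w) p = Box (fun q => pd 0 v q * pd 0 w q) p
      - Box (fun q => pd 1 v q * pd 1 w q) p - Box (fun q => pd 2 v q * pd 2 w q) p := by
  have h (a : Fin 3) : ContDiff ℝ 2 (fun q => pd a v q * pd a w q) :=
    (hv.pd (by norm_num) a).mul (hw.pd (by norm_num) a)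
  unfold Q0
  rw [Box_sub ((h 0).sub (h 1)) (h 2), Box_sub (h 0) (h 1)]

/-- with `h = (□+m_k²)v`, `h̃ = (□+m_l²)ṽ`,
`(□ + m_j²) Q₀(v,ṽ) = 2m_k²m_l² vṽ + (m_j²−m_k²−m_l²) Q₀(v,ṽ)
 + Σ C⁽¹⁾ Q_{ab}(∂^μv, ∂^νṽ) + Σ C⁽²⁾ (∂^μv)(∂^νh̃) + Σ C⁽³⁾ (∂^μh)(∂^νṽ) + C⁽⁴⁾ h h̃`,
with real constants depending only on the masses. -/
theorem box_of_null_form (mj mk ml : ℝ) :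
    ∃ (C1 : Fin 3 → Fin 3 → Option (Fin 3) → Option (Fin 3) → ℝ)
      (C2 C3 : Option (Fin 3) → Option (Fin 3) → ℝ) (C4 : ℝ),
      ∀ v vt : (Fin 3 → ℝ) → ℂ, ContDiff ℝ 4 v → ContDiff ℝ 4 vt →
        ∀ p, Box (Q0 v vt) p + mj ^ 2 • Q0 v vt p
          = (2 * mk ^ 2 * ml ^ 2) • (v p * vt p)
            + (mj ^ 2 - mk ^ 2 - ml ^ 2) • Q0 v vt p
            + (∑ a : Fin 3, ∑ b : Fin 3, ∑ μ : Option (Fin 3), ∑ ν : Option (Fin 3),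
                C1 a b μ ν • Qab a b (pdOpt μ v) (pdOpt ν vt) p)
            + (∑ μ : Option (Fin 3), ∑ ν : Option (Fin 3),
                C2 μ ν • (pdOpt μ v p *
                  pdOpt ν (fun q => Box vt q + ml ^ 2 • vt q) p))
            + (∑ μ : Option (Fin 3), ∑ ν : Option (Fin 3),
                C3 μ ν • (pdOpt μ (fun q => Box v q + mk ^ 2 • v q) p *
                  pdOpt ν vt p))
            + C4 • ((Box v p + mk ^ 2 • v p) * (Box vt p + ml ^ 2 • vt p)) := by
  refine ⟨fun a b μ ν => if μ = some a ∧ ν = some b then -2 * eta a a * eta b b else 0,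
    fun μ ν => if μ = ν then μ.elim (-2 * mk ^ 2) (fun a => -eta a a) else 0,
    fun μ ν => if μ = ν then μ.elim (-2 * ml ^ 2) (fun a => -eta a a) else 0, 2, ?_⟩
  intro v w hv4 hw4 p
  have hv : ContDiff ℝ 3 v := hv4.of_le (by norm_num)
  have hw : ContDiff ℝ 3 w := hw4.of_le (by norm_num)
  have hpv (a : Fin 3) : ContDiff ℝ 2 (pd a v) := hv.pd (by norm_num) a
  have hpw (a : Fin 3) : ContDiff ℝ 2 (pd a w) := hw.pd (by norm_num) a
  have hv2 : ContDiff ℝ 2 v := hv.of_le (by norm_num)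
  have hw2 : ContDiff ℝ 2 w := hw.of_le (by norm_num)
  rw [Box_Q0 hv hw, Box_mul (hpv 0) (hpw 0), Box_mul (hpv 1) (hpw 1), Box_mul (hpv 2) (hpw 2)]
  simp only [Fintype.sum_option, Fin.sum_univ_three, pdOpt, pd_Box_add_smul hv,
    pd_Box_add_smul hw, id]
  simp [eta]
  have hvB : Box v p = pd 0 (pd 0 v) p - pd 1 (pd 1 v) p - pd 2 (pd 2 v) p := rfl
  have hwB : Box w p = pd 0 (pd 0 w) p - pd 1 (pd 1 w) p - pd 2 (pd 2 w) p := rfl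
  simp only [hvB, hwB, Q0, Qab, pd_comm hv2 1 0, pd_comm hv2 2 0, pd_comm hv2 2 1,
    pd_comm hw2 1 0, pd_comm hw2 2 0, pd_comm hw2 2 1]
  ring

end
end
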